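/- Let V, U, W ∈ ℝ² with ‖U−V‖ = ‖W−U‖, V ≠ W and V + W ≠ 2U (isosceles, nondegenerate control triangle), and let B₂ be the quadratic Bézier curve with control points V, U, W. Then B₂′(t) ≠ 0 for all t ∈ [0,1], the function t ↦ ‖B₂′(t)‖ attains its minimum on [0,1] uniquely at t = 1/2, and consequently the curvature magnitude |κ(t)| = |cross(B₂′(t), B₂″(t))| / ‖B₂′(t)‖³ attains its maximum on [0,1] at t = 1/2, with |κ(t)| < |κ(1/2)| for every t ∈ [0,1] with t ≠ 1/2 whenever cross(U−V, W−U) ≠ 0. -/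

import Mathlib

/-- Planar cross product `cross(a,b) = a₁b₂ − a₂b₁`. -/
def cross (a b : EuclideanSpace ℝ (Fin 2)) : ℝ := a 0 * b 1 - a 1 * b 0

/-- The velocity of a quadratic Bézier curve, expanded around the parameter `1/2`. -/
theorem hasDerivAt_quadraticBezier {E : Type*} [NormedAddCommGroup E] [NormedSpace ℝ E]
    (V U W : E) (t : ℝ) :
    HasDerivAt (fun t : ℝ => (1 - t) ^ 2 • V + (2 * (1 - t) * t) • U + t ^ 2 • W)
      ((W - V) + (2 * t - 1) • (V + W - (2 : ℝ) • U)) t := by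
  have hid := hasDerivAt_id' t
  have hsub := hid.const_sub 1
  have h := (((hsub.pow 2).smul_const V).add (((hsub.const_mul 2).mul hid).smul_const U)).add
    ((hid.pow 2).smul_const W)
  refine h.congr_deriv ?_
  push_cast
  module

/-- The acceleration of a quadratic Bézier curve is constant. -/
theorem hasDerivAt_add_smul_two_mul_sub_one {E : Type*} [NormedAddCommGroup E] [NormedSpace ℝ E]
    (d e : E) (t : ℝ) :
    HasDerivAt (fun t : ℝ => d + (2 * t - 1) • e) ((2 : ℝ) • e) t := by
  have h := (((((hasDerivAt_id' t).const_mul 2).sub_const 1).smul_const e).const_add d)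
  exact h.congr_deriv (by module)

/-- In an isosceles control triangle the base is orthogonal to the axis of symmetry. -/
theorem inner_sub_add_sub_two_smul_eq_zero {E : Type*} [NormedAddCommGroup E]
    [InnerProductSpace ℝ E] {V U W : E} (h : ‖U - V‖ = ‖W - U‖) :
    inner ℝ (W - V) (V + W - (2 : ℝ) • U) = 0 := by
  have hd : W - V = (W - U) + (U - V) := by abel
  have he : V + W - (2 : ℝ) • U = (W - U) - (U - V) := by module
  rw [hd, he]
  exact (real_inner_add_sub_eq_zero_iff _ _).2 h.symm

theorem norm_sq_add_smul_of_inner_eq_zero {E : Type*} [NormedAddCommGroup E]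
    [InnerProductSpace ℝ E] {d e : E} (h : inner ℝ d e = 0) (s : ℝ) :
    ‖d + s • e‖ ^ 2 = ‖d‖ ^ 2 + s ^ 2 * ‖e‖ ^ 2 := by
  rw [norm_add_sq_real, real_inner_smul_right, h, norm_smul, mul_pow, Real.norm_eq_abs, sq_abs]
  ring

theorem cross_add_smul_smul (d e : EuclideanSpace ℝ (Fin 2)) (s c : ℝ) :
    cross (d + s • e) (c • e) = c * cross d e := by
  simp only [cross, PiLp.add_apply, PiLp.smul_apply, smul_eq_mul]
  ring

theorem cross_sub_add_sub_two_smul (V U W : EuclideanSpace ℝ (Fin 2)) :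
    cross (W - V) (V + W - (2 : ℝ) • U) = 2 * cross (U - V) (W - U) := by
  simp only [cross, PiLp.add_apply, PiLp.sub_apply, PiLp.smul_apply, smul_eq_mul]
  ring

/-- For an isosceles nondegenerate control triangle (`‖U−V‖ = ‖W−U‖`,
`V ≠ W`, `V + W ≠ 2U`), the quadratic Bézier curve satisfies: `B₂′(t) ≠ 0` on `[0,1]`;
`t ↦ ‖B₂′(t)‖` attains its minimum on `[0,1]` uniquely at `t = 1/2`; hence the curvature
magnitude `|κ(t)| = |cross(B₂′(t),B₂″(t))| / ‖B₂′(t)‖³` attains its maximum on `[0,1]` at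
`t = 1/2`, strictly so away from `1/2` whenever `cross(U−V, W−U) ≠ 0`. -/
theorem quadratic_bezier_isosceles_max_curvature_at_half
    (V U W : EuclideanSpace ℝ (Fin 2))
    (hiso : ‖U - V‖ = ‖W - U‖) (hVW : V ≠ W) (hnd : V + W ≠ (2 : ℝ) • U)
    (B : ℝ → EuclideanSpace ℝ (Fin 2))
    (hB : ∀ t : ℝ, B t = (1 - t) ^ 2 • V + (2 * (1 - t) * t) • U + t ^ 2 • W) :
    (∀ t ∈ Set.Icc (0 : ℝ) 1, deriv B t ≠ 0) ∧
    (∀ t ∈ Set.Icc (0 : ℝ) 1, t ≠ 1 / 2 → ‖deriv B (1 / 2)‖ < ‖deriv B t‖) ∧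
    (∀ t ∈ Set.Icc (0 : ℝ) 1,
      |cross (deriv B t) (deriv (deriv B) t)| / ‖deriv B t‖ ^ 3
        ≤ |cross (deriv B (1 / 2)) (deriv (deriv B) (1 / 2))| / ‖deriv B (1 / 2)‖ ^ 3) ∧
    (cross (U - V) (W - U) ≠ 0 →
      ∀ t ∈ Set.Icc (0 : ℝ) 1, t ≠ 1 / 2 →
        |cross (deriv B t) (deriv (deriv B) t)| / ‖deriv B t‖ ^ 3
          < |cross (deriv B (1 / 2)) (deriv (deriv B) (1 / 2))| / ‖deriv B (1 / 2)‖ ^ 3) := by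
  have hd : W - V ≠ 0 := sub_ne_zero.2 hVW.symm
  have he : V + W - (2 : ℝ) • U ≠ 0 := sub_ne_zero.2 hnd
  have hde := inner_sub_add_sub_two_smul_eq_zero hiso
  have hcross := cross_sub_add_sub_two_smul V U W
  have hB' : deriv B = fun t => (W - V) + (2 * t - 1) • (V + W - (2 : ℝ) • U) := by
    rw [funext hB]
    exact funext fun t => (hasDerivAt_quadraticBezier V U W t).deriv
  have hB'' : deriv (deriv B) = fun _ => (2 : ℝ) • (V + W - (2 : ℝ) • U) := by
    rw [hB']
    exact funext fun t => (hasDerivAt_add_smul_two_mul_sub_one _ _ t).deriv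
  have hhalf : deriv B (1 / 2) = W - V := by
    rw [hB']
    norm_num
  have hlt : ∀ t : ℝ, t ≠ 1 / 2 → ‖deriv B (1 / 2)‖ < ‖deriv B t‖ := by
    intro t ht
    refine lt_of_pow_lt_pow_left₀ 2 (norm_nonneg _) ?_
    rw [hhalf, hB', norm_sq_add_smul_of_inner_eq_zero hde]
    have hs : 2 * t - 1 ≠ 0 := fun h => ht (by linarith)
    have := norm_pos_iff.2 he
    have : 0 < (2 * t - 1) ^ 2 * ‖V + W - (2 : ℝ) • U‖ ^ 2 := by positivity
    linarith
  have hpos : 0 < ‖deriv B (1 / 2)‖ := by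
    rw [hhalf]
    exact norm_pos_iff.2 hd
  have hle : ∀ t : ℝ, ‖deriv B (1 / 2)‖ ≤ ‖deriv B t‖ := by
    intro t
    rcases eq_or_ne t (1 / 2) with rfl | ht
    · exact le_rfl
    · exact (hlt t ht).le
  have hc : ∀ t : ℝ, cross (deriv B t) (deriv (deriv B) t) = 4 * cross (U - V) (W - U) := by
    intro t
    rw [hB'', hB', cross_add_smul_smul, hcross]
    ring
  refine ⟨fun t _ => norm_pos_iff.1 (hpos.trans_le (hle t)), fun t _ => hlt t, ?_, ?_⟩
  · intro t _
    rw [hc, hc]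
    have := hle t
    gcongr
  · intro hne t _ ht
    rw [hc, hc]
    have := hlt t ht
    have : 0 < |4 * cross (U - V) (W - U)| := abs_pos.2 (mul_ne_zero four_ne_zero hne)
    gcongr
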